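/- arXiv:2302.02836 — 3 statements merged into one kernel-verified Lean document; each statement's English description precedes it below -/
import Mathlib

section
/- Lower bound for the norm-inflation term: there exists a constant c > 0 such that for every T ∈ (0,1), every integer r ≥ 1 and every t ∈ [T/256, T], setting k_j = 2^{3j} T^{−1/2} for j = 1,…,r, one has ∑_{j=1}^r (k_j²/j) ∫₀^t e^{−6(t−τ)} e^{−(2k_j² + 2k_j + 4)τ} dτ ≥ c · ∑_{j=1}^r 1/j. -/
open Real MeasureTheory

/-- The lacunary frequency sequence `k_j = 2^{3j} T^{-1/2}`. -/
noncomputable def kseq (T : ℝ) (j : ℕ) : ℝ := (2:ℝ)^(3*j) / Real.sqrt T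

/-- Lower bound for the norm-inflation term: there is `c > 0` such that for all
`T ∈ (0,1)`, `r ≥ 1` and `t ∈ [T/256, T]`, with `k_j = 2^{3j} T^{-1/2}`,
`∑_{j=1}^r (k_j²/j) ∫₀^t e^{-6(t-τ)} e^{-(2k_j²+2k_j+4)τ} dτ ≥ c ∑_{j=1}^r 1/j`. -/
theorem stmt_13 : ∃ c : ℝ, 0 < c ∧
    ∀ T : ℝ, T ∈ Set.Ioo (0:ℝ) 1 → ∀ r : ℕ, 1 ≤ r → ∀ t : ℝ, t ∈ Set.Icc (T/256) T →
      c * (∑ j ∈ Finset.Icc 1 r, (1:ℝ)/(j:ℝ)) ≤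
        ∑ j ∈ Finset.Icc 1 r, (kseq T j)^2 / (j:ℝ) *
          ∫ τ in (0:ℝ)..t,
            Real.exp (-6*(t-τ)) *
              Real.exp (-(2*(kseq T j)^2 + 2*(kseq T j) + 4)*τ) := by
  refine ⟨Real.exp (-8) / 4, by positivity, ?_⟩
  rintro T ⟨hT0, hT1⟩ r hr t ⟨ht1, ht2⟩
  rw [Finset.mul_sum]
  refine Finset.sum_le_sum fun j hj => ?_
  have hj1 : 1 ≤ j := (Finset.mem_Icc.mp hj).1
  have hjpos : (0:ℝ) < j := by exact_mod_cast hj1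
  have hsq : 0 < Real.sqrt T := Real.sqrt_pos.mpr hT0
  have hsq1 : Real.sqrt T ≤ 1 := Real.sqrt_le_one.mpr hT1.le
  have h8 : (8:ℝ) ≤ (2:ℝ)^(3*j) := by
    calc (8:ℝ) = (2:ℝ)^3 := by norm_num
      _ ≤ (2:ℝ)^(3*j) := pow_le_pow_right₀ (by norm_num) (by omega)
  have hkmul : kseq T j * Real.sqrt T = (2:ℝ)^(3*j) := by
    unfold kseq
    field_simp
  have hkpos : 0 < kseq T j := by
    unfold kseq
    positivity
  generalize kseq T j = k at hkmul hkpos ⊢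
  have hk1 : 1 ≤ k := by nlinarith
  have hkT : 64 ≤ k^2 * T := by
    have h1 : k^2 * T = (k * Real.sqrt T)^2 := by
      rw [mul_pow, Real.sq_sqrt hT0.le]
    rw [h1, hkmul]
    nlinarith
  have hk2 : 0 < k^2 := by positivity
  have hs0 : 0 ≤ 1 / (4 * k^2) := by positivity
  have hst : 1 / (4 * k^2) ≤ t := by
    rw [div_le_iff₀ (by positivity)]
    nlinarith
  have hcont : Continuous fun τ : ℝ => Real.exp (-6*(t-τ)) *
      Real.exp (-(2*k^2 + 2*k + 4)*τ) := by fun_prop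
  have hA : (∫ τ in (0:ℝ)..(1 / (4 * k^2)), Real.exp (-6*(t-τ)) *
      Real.exp (-(2*k^2 + 2*k + 4)*τ)) ≤ ∫ τ in (0:ℝ)..t, Real.exp (-6*(t-τ)) *
      Real.exp (-(2*k^2 + 2*k + 4)*τ) := by
    refine intervalIntegral.integral_mono_interval le_rfl hs0 hst ?_
      (hcont.intervalIntegrable _ _)
    exact Filter.Eventually.of_forall fun τ => by positivity
  have hB : (∫ τ in (0:ℝ)..(1 / (4 * k^2)), Real.exp (-8)) ≤
      ∫ τ in (0:ℝ)..(1 / (4 * k^2)), Real.exp (-6*(t-τ)) *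
      Real.exp (-(2*k^2 + 2*k + 4)*τ) := by
    refine intervalIntegral.integral_mono_on hs0 (by simp)
      (hcont.intervalIntegrable _ _) ?_
    rintro τ ⟨h0, h1⟩
    rw [← Real.exp_add]
    apply Real.exp_le_exp.mpr
    rw [le_div_iff₀ (by positivity)] at h1
    have h3 : (2*k^2 + 2*k + 4) * τ ≤ (8*k^2) * τ :=
      mul_le_mul_of_nonneg_right (by nlinarith) h0
    nlinarith
  rw [intervalIntegral.integral_const, smul_eq_mul, sub_zero] at hB
  calc Real.exp (-8) / 4 * (1 / (j:ℝ))
      = k^2 / j * (1 / (4 * k^2) * Real.exp (-8)) := by field_simp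
    _ ≤ _ := mul_le_mul_of_nonneg_left (hB.trans hA) (by positivity)
end

section
/- Uniform bound on cross interactions: there exists a constant C > 0 such that for every T ∈ (0,1), every integer r ≥ 2 and every t > 0, setting k_j = 2^{3j} T^{−1/2}, one has ∑_{j=2}^r ∑_{i=1}^{j−1} (k_i k_j / √(i j)) ∫₀^t ( e^{−(k_j−k_i−1)²(t−τ)} + e^{−(k_j+k_i+1)²(t−τ)} ) e^{−(k_i² + k_j²)τ} dτ ≤ C. -/
open Real MeasureTheory

lemma kseq_pos {T : ℝ} (hT : T ∈ Set.Ioo (0:ℝ) 1) (j : ℕ) : 0 < kseq T j := by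
  unfold kseq
  have := Real.sqrt_pos.2 hT.1
  positivity

lemma kseq_succ (T : ℝ) (j : ℕ) : kseq T (j+1) = 8 * kseq T j := by
  unfold kseq
  rw [show 3*(j+1) = 3*j+3 by ring, pow_add]
  ring

lemma kseq_ge {T : ℝ} (hT : T ∈ Set.Ioo (0:ℝ) 1) (j : ℕ) (hj : 1 ≤ j) : 8 ≤ kseq T j := by
  induction j, hj using Nat.le_induction with
  | base =>
    unfold kseq
    have h0 := Real.sqrt_pos.2 hT.1
    have h1 : Real.sqrt T ≤ 1 := Real.sqrt_le_one.2 hT.2.le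
    rw [le_div_iff₀ h0]
    norm_num
    exact hT.2.le
  | succ n _ ih => rw [kseq_succ]; linarith

lemma kseq_lt {T : ℝ} (hT : T ∈ Set.Ioo (0:ℝ) 1) (i j : ℕ) (hij : i + 1 ≤ j) :
    8 * kseq T i ≤ kseq T j := by
  induction j, hij using Nat.le_induction with
  | base => rw [kseq_succ]
  | succ n _ ih =>
    rw [kseq_succ]
    have := kseq_pos hT n
    linarith

lemma kseq_sum {T : ℝ} (hT : T ∈ Set.Ioo (0:ℝ) 1) (n : ℕ) :
    ∑ i ∈ Finset.Icc 1 n, kseq T i ≤ kseq T (n+1) := by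
  induction n with
  | zero => simpa using (kseq_pos hT 1).le
  | succ n ih =>
    rw [Finset.sum_Icc_succ_top (by omega), kseq_succ T (n+1)]
    have := kseq_pos hT (n+1)
    linarith

lemma exp_bound {a x y t τ : ℝ} (hτ : 0 ≤ τ) (hτt : τ ≤ t) (hx : a ≤ x) (hy : a ≤ y) :
    Real.exp (-x * (t-τ)) * Real.exp (-y * τ) ≤ Real.exp (-(a*t)) := by
  rw [← Real.exp_add]
  apply Real.exp_le_exp.2
  nlinarith [mul_nonneg (sub_nonneg.2 hx) (sub_nonneg.2 hτt), mul_nonneg (sub_nonneg.2 hy) hτ]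

lemma tele {x : ℝ} (hx : 0 < x) :
    2 * x * Real.exp (-(x/4)) ≤ 4096 * (1/(1+x) - 1/(1+64*x)) := by
  have h1 : 1 + x/4 + (x/4)^2/2 ≤ Real.exp (x/4) := Real.quadratic_le_exp_of_nonneg (by positivity)
  have h2 : 1/(1+x) - 1/(1+64*x) = 63*x/((1+x)*(1+64*x)) := by
    field_simp
    ring
  rw [h2, Real.exp_neg, ← div_eq_mul_inv, ← mul_div_assoc,
    div_le_div_iff₀ (Real.exp_pos _) (by positivity)]
  have h3 : (1+x)*(1+64*x) ≤ 2048 * Real.exp (x/4) := by nlinarith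
  nlinarith [mul_le_mul_of_nonneg_left h3 hx.le, mul_pos hx (Real.exp_pos (x/4))]

lemma int_bound {T : ℝ} (hT : T ∈ Set.Ioo (0:ℝ) 1) {t : ℝ} (ht : 0 < t) (i j : ℕ)
    (hij : i + 1 ≤ j) :
    ∫ τ in (0:ℝ)..t,
            (Real.exp (-(kseq T j - kseq T i - 1)^2 * (t-τ)) +
              Real.exp (-(kseq T j + kseq T i + 1)^2 * (t-τ))) *
              Real.exp (-((kseq T i)^2 + (kseq T j)^2)*τ)
      ≤ 2 * Real.exp (-((kseq T j)^2/4*t)) * t := by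
  have hi := kseq_pos hT i
  have hj := kseq_pos hT j
  have h8 := kseq_ge hT j (by omega)
  have hl := kseq_lt hT i j hij
  refine (le_abs_self _).trans ?_
  have := intervalIntegral.norm_integral_le_of_norm_le_const (a := 0) (b := t)
    (C := 2 * Real.exp (-((kseq T j)^2/4*t))) (f := fun τ =>
      (Real.exp (-(kseq T j - kseq T i - 1)^2 * (t-τ)) +
              Real.exp (-(kseq T j + kseq T i + 1)^2 * (t-τ))) *
              Real.exp (-((kseq T i)^2 + (kseq T j)^2)*τ)) ?_
  · rwa [sub_zero, abs_of_pos ht, Real.norm_eq_abs] at this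
  · intro τ hτ
    rw [Set.uIoc_of_le ht.le] at hτ
    rw [Real.norm_eq_abs, abs_of_pos (by positivity), add_mul, two_mul]
    have hy : (kseq T j)^2/4 ≤ (kseq T i)^2 + (kseq T j)^2 := by nlinarith
    have hx1 : (kseq T j)^2/4 ≤ (kseq T j - kseq T i - 1)^2 := by nlinarith
    have hx2 : (kseq T j)^2/4 ≤ (kseq T j + kseq T i + 1)^2 := by nlinarith
    exact add_le_add (exp_bound hτ.1.le hτ.2 hx1 hy) (exp_bound hτ.1.le hτ.2 hx2 hy)

lemma inner_bound {T : ℝ} (hT : T ∈ Set.Ioo (0:ℝ) 1) {t : ℝ} (ht : 0 < t) (j : ℕ) (hj : 1 ≤ j) :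
    (∑ i ∈ Finset.Icc 1 (j-1),
        kseq T i * kseq T j / Real.sqrt ((i:ℝ)*(j:ℝ)) *
          ∫ τ in (0:ℝ)..t,
            (Real.exp (-(kseq T j - kseq T i - 1)^2 * (t-τ)) +
              Real.exp (-(kseq T j + kseq T i + 1)^2 * (t-τ))) *
              Real.exp (-((kseq T i)^2 + (kseq T j)^2)*τ))
      ≤ 2 * ((kseq T j)^2*t) * Real.exp (-(((kseq T j)^2*t)/4)) := by
  have hjp := kseq_pos hT j
  have hs := kseq_sum hT (j-1)
  rw [Nat.sub_add_cancel hj] at hs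
  calc _ ≤ ∑ i ∈ Finset.Icc 1 (j-1), kseq T i * (kseq T j *
        (2 * Real.exp (-((kseq T j)^2/4*t)) * t)) := by
        apply Finset.sum_le_sum
        intro i hi
        rw [Finset.mem_Icc] at hi
        have hip := kseq_pos hT i
        have hb := int_bound hT ht i j (by omega)
        have h1 : 1 ≤ Real.sqrt ((i:ℝ)*(j:ℝ)) := by
          rw [Real.one_le_sqrt]
          have a1 : (1:ℝ) ≤ i := by exact_mod_cast hi.1
          have a2 : (1:ℝ) ≤ j := by exact_mod_cast hj
          nlinarith
        rw [← mul_assoc]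
        refine (mul_le_mul_of_nonneg_left hb (by positivity)).trans ?_
        exact mul_le_mul_of_nonneg_right (div_le_self (by positivity) h1) (by positivity)
    _ = (∑ i ∈ Finset.Icc 1 (j-1), kseq T i) * (kseq T j *
        (2 * Real.exp (-((kseq T j)^2/4*t)) * t)) := by rw [Finset.sum_mul]
    _ ≤ kseq T j * (kseq T j * (2 * Real.exp (-((kseq T j)^2/4*t)) * t)) :=
        mul_le_mul_of_nonneg_right hs (by positivity)
    _ = _ := by
        rw [show (kseq T j)^2/4*t = ((kseq T j)^2*t)/4 by ring]
        ring

/-- Uniform bound on cross interactions: there is `C > 0` such that for all `T ∈ (0,1)`,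
`r ≥ 2` and `t > 0`, with `k_j = 2^{3j} T^{-1/2}`,
`∑_{j=2}^r ∑_{i=1}^{j-1} (k_i k_j/√(ij)) ∫₀^t (e^{-(k_j-k_i-1)²(t-τ)} +
e^{-(k_j+k_i+1)²(t-τ)}) e^{-(k_i²+k_j²)τ} dτ ≤ C`. -/
theorem stmt_14 : ∃ C : ℝ, 0 < C ∧
    ∀ T : ℝ, T ∈ Set.Ioo (0:ℝ) 1 → ∀ r : ℕ, 2 ≤ r → ∀ t : ℝ, 0 < t →
      (∑ j ∈ Finset.Icc 2 r, ∑ i ∈ Finset.Icc 1 (j-1),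
        kseq T i * kseq T j / Real.sqrt ((i:ℝ)*(j:ℝ)) *
          ∫ τ in (0:ℝ)..t,
            (Real.exp (-(kseq T j - kseq T i - 1)^2 * (t-τ)) +
              Real.exp (-(kseq T j + kseq T i + 1)^2 * (t-τ))) *
              Real.exp (-((kseq T i)^2 + (kseq T j)^2)*τ)) ≤ C := by
  refine ⟨4096, by norm_num, ?_⟩
  intro T hT r hr t ht
  have key : ∀ r : ℕ, 1 ≤ r → ∑ j ∈ Finset.Icc 2 r,
      2 * ((kseq T j)^2*t) * Real.exp (-(((kseq T j)^2*t)/4)) ≤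
      4096 * (1 - 1/(1 + (kseq T (r+1))^2*t)) := by
    intro r hr
    induction r, hr using Nat.le_induction with
    | base =>
      have : 1/(1 + (kseq T (1+1))^2*t) ≤ 1 := by
        have : 0 ≤ (kseq T (1+1))^2*t := by positivity
        rw [div_le_one (by positivity)]
        linarith
      simp only [show Finset.Icc 2 1 = ∅ from rfl, Finset.sum_empty]
      linarith
    | succ n hn ih =>
      rw [Finset.sum_Icc_succ_top (by omega)]
      have hp := kseq_pos hT (n+1)
      have h := tele (x := (kseq T (n+1))^2*t) (by positivity)
      rw [kseq_succ T (n+1), show (8 * kseq T (n+1))^2*t = 64 * ((kseq T (n+1))^2*t) by ring]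
      linarith
  refine (Finset.sum_le_sum fun j hj =>
    inner_bound hT ht j (by rw [Finset.mem_Icc] at hj; omega)).trans ?_
  refine (key r (by omega)).trans ?_
  have : 0 ≤ 1/(1 + (kseq T (r+1))^2*t) := by positivity
  linarith
end

section
/- Uniform bound on the high-frequency resonant part: there exists a constant C > 0 such that for every T ∈ (0,1), every integer r ≥ 1 and every t > 0, setting k_j = 2^{3j} T^{−1/2}, one has ∑_{j=1}^r (k_j²/j) ∫₀^t e^{−(1+(2k_j+1)²)(t−τ)} e^{−(2k_j² + 2k_j + 4)τ} dτ ≤ C. -/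
open Real MeasureTheory

lemma term_bound (k t : ℝ) (hk : 0 ≤ k) (ht : 0 < t) (j : ℕ) (hj : 1 ≤ j) :
    k^2 / (j:ℝ) * (∫ τ in (0:ℝ)..t,
      Real.exp (-(1+(2*k+1)^2) * (t-τ)) * Real.exp (-(2*k^2 + 2*k + 4)*τ))
      ≤ Real.exp (-(k^2*t)) - Real.exp (-(64*(k^2*t))) := by
  have hI : (∫ τ in (0:ℝ)..t,
      Real.exp (-(1+(2*k+1)^2) * (t-τ)) * Real.exp (-(2*k^2 + 2*k + 4)*τ))
      ≤ Real.exp (-(2*(k^2*t))) * t := by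
    have h := intervalIntegral.norm_integral_le_of_norm_le_const (a := 0) (b := t)
      (f := fun τ => Real.exp (-(1+(2*k+1)^2) * (t-τ)) * Real.exp (-(2*k^2 + 2*k + 4)*τ))
      (C := Real.exp (-(2*(k^2*t)))) (by
        intro τ hτ
        rw [Set.uIoc_of_le ht.le] at hτ
        obtain ⟨h0, h1⟩ := hτ
        rw [← Real.exp_add, Real.norm_eq_abs, abs_of_pos (Real.exp_pos _)]
        apply Real.exp_le_exp.mpr
        have h2 : 0 ≤ (2*k^2+4*k+2) * (t-τ) :=
          mul_nonneg (by positivity) (by linarith)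
        have h3 : 0 ≤ (2*k+4) * τ := by positivity
        nlinarith)
    rw [sub_zero, abs_of_pos ht] at h
    exact (Real.le_norm_self _).trans h
  have hj' : (1:ℝ) ≤ j := by exact_mod_cast hj
  have hx : 0 ≤ k^2*t := by positivity
  have e1 : Real.exp (-(k^2*t)) = Real.exp (-(2*(k^2*t))) * Real.exp (k^2*t) := by
    rw [← Real.exp_add]; congr 1; ring
  have e2 : Real.exp (-(64*(k^2*t))) ≤ Real.exp (-(2*(k^2*t))) :=
    Real.exp_le_exp.mpr (by linarith)
  have e3 := Real.add_one_le_exp (k^2*t)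
  have e4 := Real.exp_pos (-(2*(k^2*t)))
  calc _ ≤ k^2 / (j:ℝ) * (Real.exp (-(2*(k^2*t))) * t) :=
        mul_le_mul_of_nonneg_left hI (by positivity)
    _ ≤ k^2 * (Real.exp (-(2*(k^2*t))) * t) :=
        mul_le_mul_of_nonneg_right (div_le_self (by positivity) hj') (by positivity)
    _ ≤ _ := by
        rw [e1]
        nlinarith [mul_le_mul_of_nonneg_left e3 e4.le]

/-- Uniform bound on the high-frequency resonant part: there is `C > 0` such that for
all `T ∈ (0,1)`, `r ≥ 1` and `t > 0`, with `k_j = 2^{3j} T^{-1/2}`,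
`∑_{j=1}^r (k_j²/j) ∫₀^t e^{-(1+(2k_j+1)²)(t-τ)} e^{-(2k_j²+2k_j+4)τ} dτ ≤ C`. -/
theorem stmt_15 : ∃ C : ℝ, 0 < C ∧
    ∀ T : ℝ, T ∈ Set.Ioo (0:ℝ) 1 → ∀ r : ℕ, 1 ≤ r → ∀ t : ℝ, 0 < t →
      (∑ j ∈ Finset.Icc 1 r, (kseq T j)^2 / (j:ℝ) *
        ∫ τ in (0:ℝ)..t,
          Real.exp (-(1+(2*(kseq T j)+1)^2) * (t-τ)) *
            Real.exp (-(2*(kseq T j)^2 + 2*(kseq T j) + 4)*τ)) ≤ C := by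
  refine ⟨1, one_pos, ?_⟩
  intro T _ r _ t ht
  have key : ∀ r : ℕ, (∑ j ∈ Finset.Icc 1 r, (kseq T j)^2 / (j:ℝ) *
        ∫ τ in (0:ℝ)..t,
          Real.exp (-(1+(2*(kseq T j)+1)^2) * (t-τ)) *
            Real.exp (-(2*(kseq T j)^2 + 2*(kseq T j) + 4)*τ))
      ≤ 1 - Real.exp (-((kseq T (r+1))^2*t)) := by
    intro r
    induction r with
    | zero =>
      have : Real.exp (-((kseq T (0+1))^2*t)) ≤ 1 :=
        Real.exp_le_one_iff.mpr (neg_nonpos.mpr (by positivity))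
      simpa using this
    | succ n ih =>
      rw [Finset.sum_Icc_succ_top (by omega)]
      have hk : 0 ≤ kseq T (n+1) := by unfold kseq; positivity
      have h := term_bound (kseq T (n+1)) t hk ht (n+1) (by omega)
      have hs : kseq T (n+1+1) = 8 * kseq T (n+1) := by
        unfold kseq
        rw [show 3*(n+1+1) = 3*(n+1)+3 by ring, pow_add]
        ring
      have hs2 : (kseq T (n+1+1))^2*t = 64*((kseq T (n+1))^2*t) := by rw [hs]; ring
      rw [hs2]
      linarith
  have := key r
  have := Real.exp_pos (-((kseq T (r+1))^2*t))
  linarith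
end
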